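/- Let n ∈ ℚ be positive. (i) If l ≥ 1, α ∈ ℂ[C] is a polynomial in C of degree k, and U = α·A^l, then η_n(U) = β·A^{l−1} for some β ∈ ℂ[C] of degree k + 1 (with A⁰ = 1). (ii) If l ∈ ℕ, α ∈ ℂ[C] has degree k, and U = α·B^l, then η_n(U) = β·B^{l+1} for some β ∈ ℂ[C] of degree k. -/

import Mathlib

noncomputable section

/-- Generators of the `q`-deformed Heisenberg algebra. -/
inductive HGen : Type
  | A : HGen
  | B : HGen

/-- The defining relation `AB = q • BA + 1` of the `q`-deformed Heisenberg algebra. -/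
inductive HRel (q : ℂ) : FreeAlgebra ℂ HGen → FreeAlgebra ℂ HGen → Prop
  | rel : HRel q (FreeAlgebra.ι ℂ HGen.A * FreeAlgebra.ι ℂ HGen.B)
      (q • (FreeAlgebra.ι ℂ HGen.B * FreeAlgebra.ι ℂ HGen.A) + 1)

/-- The `q`-deformed Heisenberg algebra `H(q)`, presented by generators `A`, `B`
and the single relation `AB - q • BA = 1`. -/
abbrev HAlg (q : ℂ) := RingQuot (HRel q)

/-- The generator `A` of `H(q)`. -/
def genA (q : ℂ) : HAlg q := RingQuot.mkAlgHom ℂ (HRel q) (FreeAlgebra.ι ℂ HGen.A)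

/-- The generator `B` of `H(q)`. -/
def genB (q : ℂ) : HAlg q := RingQuot.mkAlgHom ℂ (HRel q) (FreeAlgebra.ι ℂ HGen.B)

/-- The element `C = AB - BA` of `H(q)`. -/
def genC (q : ℂ) : HAlg q := genA q * genB q - genB q * genA q

/-- `q = e^{-2ω}`. -/
def qOf (ω : ℝ) : ℂ := Complex.exp (-2 * (ω : ℂ))

/-- `q^r = e^{-2ωr}` for a rational exponent `r`. -/
def qexp (ω : ℝ) (r : ℚ) : ℂ := Complex.exp (-2 * (ω : ℂ) * (r : ℂ))

/-- The deformed commutator map `θ_n : γ ↦ Aγ - q^n γA` on `H(q)`, `n ∈ ℚ`. -/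
def thetaQ (ω : ℝ) (n : ℚ) (x : HAlg (qOf ω)) : HAlg (qOf ω) :=
  genA (qOf ω) * x - qexp ω n • (x * genA (qOf ω))

/-- The deformed commutator map `η_n : γ ↦ Bγ - q^n γB` on `H(q)`, `n ∈ ℚ`. -/
def etaQ (ω : ℝ) (n : ℚ) (x : HAlg (qOf ω)) : HAlg (qOf ω) :=
  genB (qOf ω) * x - qexp ω n • (x * genB (qOf ω))

section CommutationRules

variable {R : Type*} [Ring R] [Algebra ℂ R] {q : ℂ} {a b : R}

lemma mul_commutator_eq_smul (h : a * b = q • (b * a) + 1) :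
    a * (a * b - b * a) = q • ((a * b - b * a) * a) := by
  have h₁ : a * b * a = q • (b * a * a) + a := by rw [h, add_mul, smul_mul_assoc, one_mul]
  have h₂ : a * (a * b) = q • (a * b * a) + a := by
    conv_lhs => rw [h]
    rw [mul_add, mul_smul_comm, mul_one, mul_assoc a b a]
  rw [mul_sub, sub_mul, ← mul_assoc a b a, h₂, smul_sub, ← sub_eq_zero]
  have h₃ : q • (b * a * a) = a * b * a - a := by rw [h₁, add_sub_cancel_right]
  rw [h₃]
  abel

lemma commutator_mul_eq_smul (h : a * b = q • (b * a) + 1) :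
    (a * b - b * a) * b = q • (b * (a * b - b * a)) := by
  have h₁ : b * (a * b) = q • (b * (b * a)) + b := by rw [h, mul_add, mul_smul_comm, mul_one]
  have h₂ : a * b * b = q • (b * (a * b)) + b := by
    conv_lhs => rw [h]
    rw [add_mul, smul_mul_assoc, one_mul, mul_assoc]
  have h₃ : q • (b * (b * a)) = b * (a * b) - b := by rw [h₁, add_sub_cancel_right]
  rw [sub_mul, mul_sub, smul_sub, h₂, h₃, mul_assoc b a b]
  abel

lemma mul_commutator_pow (hq : q ≠ 0) (h : a * b = q • (b * a) + 1) (i : ℕ) :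
    b * (a * b - b * a) ^ i = (q⁻¹) ^ i • ((a * b - b * a) ^ i * b) := by
  have h₁ : b * (a * b - b * a) = q⁻¹ • ((a * b - b * a) * b) := by
    rw [commutator_mul_eq_smul h, smul_smul, inv_mul_cancel₀ hq, one_smul]
  induction i with
  | zero => simp
  | succ i ih =>
    rw [pow_succ, ← mul_assoc, ih, smul_mul_assoc, mul_assoc, h₁, mul_smul_comm, smul_smul,
      ← mul_assoc, ← pow_succ, ← pow_succ]

lemma pow_mul_commutator (h : a * b = q • (b * a) + 1) (l : ℕ) :
    a ^ l * (a * b - b * a) = q ^ l • ((a * b - b * a) * a ^ l) := by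
  induction l with
  | zero => simp
  | succ l ih =>
    rw [pow_succ, mul_assoc, mul_commutator_eq_smul h, mul_smul_comm, ← mul_assoc, ih,
      smul_mul_assoc, smul_smul, mul_assoc, ← pow_succ, ← pow_succ']

lemma mul_eq_smul_commutator_sub_one (hq : q ≠ 1) (h : a * b = q • (b * a) + 1) :
    b * a = (q - 1)⁻¹ • ((a * b - b * a) - 1) := by
  have h₁ : (a * b - b * a) - 1 = (q - 1) • (b * a) := by
    rw [h, sub_smul, one_smul]
    abel
  rw [h₁, smul_smul, inv_mul_cancel₀ (sub_ne_zero.2 hq), one_smul]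

lemma mul_eq_smul_smul_commutator_sub_one (hq : q ≠ 1) (h : a * b = q • (b * a) + 1) :
    a * b = (q - 1)⁻¹ • (q • (a * b - b * a) - 1) := by
  have h₁ : q • (a * b - b * a) - 1 = (q - 1) • (a * b) := by
    have h₂ : q • (b * a) = a * b - 1 := by rw [h, add_sub_cancel_right]
    rw [smul_sub, h₂, sub_smul, one_smul]
    abel
  rw [h₁, smul_smul, inv_mul_cancel₀ (sub_ne_zero.2 hq), one_smul]

lemma pow_succ_mul (hq : q ≠ 1) (h : a * b = q • (b * a) + 1) (l : ℕ) :
    a ^ (l + 1) * b = (q - 1)⁻¹ • ((q ^ (l + 1) • (a * b - b * a) - 1) * a ^ l) := by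
  rw [pow_succ, mul_assoc]
  conv_lhs => rw [mul_eq_smul_smul_commutator_sub_one hq h]
  rw [mul_smul_comm, mul_sub, mul_smul_comm, pow_mul_commutator h, smul_smul,
    mul_one, sub_mul (q ^ (l + 1) • _), smul_mul_assoc, one_mul, pow_succ']

lemma deformed_commutator_mul_pow_left (hq₀ : q ≠ 0) (hq : q ≠ 1)
    (h : a * b = q • (b * a) + 1) (s : ℂ) (i l : ℕ) :
    b * ((a * b - b * a) ^ i * a ^ (l + 1)) - s • ((a * b - b * a) ^ i * a ^ (l + 1) * b) =
      ((((q⁻¹) ^ i - s * q ^ (l + 1)) * (q - 1)⁻¹) • (a * b - b * a) ^ (i + 1) +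
        ((s - (q⁻¹) ^ i) * (q - 1)⁻¹) • (a * b - b * a) ^ i) * a ^ l := by
  have hbc := mul_commutator_pow hq₀ h i
  have hba := mul_eq_smul_commutator_sub_one hq h
  have hab := pow_succ_mul hq h l
  generalize a * b - b * a = c at *
  have h₁ : b * (c ^ i * a ^ (l + 1)) = (q⁻¹) ^ i • (c ^ i * (b * a) * a ^ l) := by
    rw [← mul_assoc, hbc, smul_mul_assoc, pow_succ' a l]
    simp only [mul_assoc]
  rw [h₁, hba, mul_assoc (c ^ i) _ b, hab, pow_succ c i]
  simp only [add_mul, sub_mul, mul_sub, smul_mul_assoc, mul_smul_comm, smul_sub, one_mul,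
    mul_one, mul_assoc]
  module

lemma deformed_commutator_mul_pow_right (hq₀ : q ≠ 0) (h : a * b = q • (b * a) + 1)
    (s : ℂ) (i l : ℕ) :
    b * ((a * b - b * a) ^ i * b ^ l) - s • ((a * b - b * a) ^ i * b ^ l * b) =
      ((q⁻¹) ^ i - s) • ((a * b - b * a) ^ i * b ^ (l + 1)) := by
  rw [← mul_assoc, mul_commutator_pow hq₀ h, smul_mul_assoc, mul_assoc _ b, ← pow_succ',
    mul_assoc _ _ b, ← pow_succ, sub_smul]

end CommutationRules

lemma sum_range_smul_pow_succ_add_smul_pow {R : Type*} [Ring R] [Algebra ℂ R] (x : R)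
    (u v : ℕ → ℂ) (k : ℕ) :
    ∃ d : ℕ → ℂ, d (k + 1) = u k ∧
      ∑ i ∈ Finset.range (k + 1), (u i • x ^ (i + 1) + v i • x ^ i) =
        ∑ i ∈ Finset.range (k + 2), d i • x ^ i := by
  refine ⟨fun j => (if j = 0 then 0 else u (j - 1)) + (if j = k + 1 then 0 else v j), by simp, ?_⟩
  simp only [add_smul, Finset.sum_add_distrib]
  congr 1
  · rw [Finset.sum_range_succ' _ (k + 1)]
    simp
  · rw [Finset.sum_range_succ _ (k + 1)]
    simp only [if_true, zero_smul, add_zero]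
    refine Finset.sum_congr rfl fun i hi => ?_
    rw [if_neg (Finset.mem_range.1 hi).ne]

lemma genA_mul_genB (q : ℂ) : genA q * genB q = q • (genB q * genA q) + 1 := by
  simpa [genA, genB] using RingQuot.mkAlgHom_rel ℂ (HRel.rel (q := q))

lemma norm_qOf_lt_one {ω : ℝ} (hω : 0 < ω) : ‖qOf ω‖ < 1 := by
  simp [qOf, Complex.norm_exp, hω]

lemma norm_qexp_lt_one {ω : ℝ} (hω : 0 < ω) {n : ℚ} (hn : 0 < n) : ‖qexp ω n‖ < 1 := by
  have h : -2 * (ω : ℂ) * (n : ℂ) = ((-2 * ω * n : ℝ) : ℂ) := by push_cast; ring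
  have hn' : (0 : ℝ) < n := by exact_mod_cast hn
  rw [qexp, h, Complex.norm_exp, Complex.ofReal_re, Real.exp_lt_one_iff]
  nlinarith [mul_pos hω hn']

lemma inv_pow_sub_ne_zero {q s : ℂ} (hq₀ : q ≠ 0) (hq : ‖q‖ ≤ 1) (hs : ‖s‖ < 1) (i : ℕ) :
    (q⁻¹) ^ i - s ≠ 0 := by
  rw [sub_ne_zero]
  rintro rfl
  rw [norm_pow, norm_inv] at hs
  exact hs.not_ge (one_le_pow₀ ((one_le_inv₀ (norm_pos_iff.2 hq₀)).2 hq))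

lemma etaQ_sum_mul (ω : ℝ) (n : ℚ) (k : ℕ) (c : ℕ → ℂ) (y : HAlg (qOf ω)) :
    etaQ ω n ((∑ i ∈ Finset.range (k + 1), c i • genC (qOf ω) ^ i) * y) =
      ∑ i ∈ Finset.range (k + 1), c i • etaQ ω n (genC (qOf ω) ^ i * y) := by
  simp only [etaQ, Finset.sum_mul, Finset.mul_sum, Finset.smul_sum, smul_sub,
    Finset.sum_sub_distrib, smul_mul_assoc, mul_smul_comm]
  simp only [smul_comm (qexp ω n)]

/-- Let `q = e^{-2ω}`, `ω > 0`, and let `n ∈ ℚ` be positive.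
(i) If `l ≥ 1` and `α = ∑_{i=0}^k c_i C^i ∈ ℂ[C]` has degree `k` (i.e. `c_k ≠ 0`), and
`U = α·A^l`, then `η_n(U) = β·A^{l-1}` for some `β ∈ ℂ[C]` of degree `k + 1`.
(ii) If `l ∈ ℕ` and `α ∈ ℂ[C]` has degree `k` and `U = α·B^l`, then
`η_n(U) = β·B^{l+1}` for some `β ∈ ℂ[C]` of degree `k`. -/
theorem statement_4 (ω : ℝ) (hω : 0 < ω) (n : ℚ) (hn : 0 < n) (k : ℕ) (c : ℕ → ℂ)
    (hc : c k ≠ 0) :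
    (∀ l : ℕ, 1 ≤ l →
      ∃ d : ℕ → ℂ, d (k + 1) ≠ 0 ∧
        etaQ ω n ((∑ i ∈ Finset.range (k + 1), c i • genC (qOf ω) ^ i) * genA (qOf ω) ^ l) =
          (∑ i ∈ Finset.range (k + 2), d i • genC (qOf ω) ^ i) * genA (qOf ω) ^ (l - 1)) ∧
    (∀ l : ℕ,
      ∃ d : ℕ → ℂ, d k ≠ 0 ∧
        etaQ ω n ((∑ i ∈ Finset.range (k + 1), c i • genC (qOf ω) ^ i) * genB (qOf ω) ^ l) =
          (∑ i ∈ Finset.range (k + 1), d i • genC (qOf ω) ^ i) * genB (qOf ω) ^ (l + 1)) := by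
  have hq₀ : qOf ω ≠ 0 := Complex.exp_ne_zero _
  have hq₁ := norm_qOf_lt_one hω
  have hs := norm_qexp_lt_one hω hn
  have hq : qOf ω ≠ 1 := fun h => by simp [h] at hq₁
  have hrel := genA_mul_genB (qOf ω)
  refine ⟨fun l hl => ?_, fun l => ?_⟩
  · obtain ⟨l, rfl⟩ := Nat.exists_eq_add_of_le' hl
    obtain ⟨d, hd, hsum⟩ := sum_range_smul_pow_succ_add_smul_pow (genC (qOf ω))
      (fun i => c i * (((qOf ω)⁻¹ ^ i - qexp ω n * qOf ω ^ (l + 1)) * (qOf ω - 1)⁻¹))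
      (fun i => c i * ((qexp ω n - (qOf ω)⁻¹ ^ i) * (qOf ω - 1)⁻¹)) k
    refine ⟨d, ?_, ?_⟩
    · rw [hd]
      refine mul_ne_zero hc (mul_ne_zero (inv_pow_sub_ne_zero hq₀ hq₁.le ?_ k)
        (inv_ne_zero (sub_ne_zero.2 hq)))
      rw [norm_mul, norm_pow]
      exact mul_lt_one_of_nonneg_of_lt_one_left (norm_nonneg _) hs
        (pow_le_one₀ (norm_nonneg _) hq₁.le)
    · rw [etaQ_sum_mul, ← hsum, Nat.add_sub_cancel, Finset.sum_mul]
      refine Finset.sum_congr rfl fun i _ => ?_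
      rw [mul_smul (c i), mul_smul (c i), ← smul_add, smul_mul_assoc]
      exact congrArg (c i • ·) (deformed_commutator_mul_pow_left hq₀ hq hrel (qexp ω n) i l)
  · refine ⟨fun i => c i * ((qOf ω)⁻¹ ^ i - qexp ω n),
      mul_ne_zero hc (inv_pow_sub_ne_zero hq₀ hq₁.le hs k), ?_⟩
    rw [etaQ_sum_mul, Finset.sum_mul]
    refine Finset.sum_congr rfl fun i _ => ?_
    rw [mul_smul, smul_mul_assoc, smul_mul_assoc]
    exact congrArg (c i • ·) (deformed_commutator_mul_pow_right hq₀ hrel (qexp ω n) i l)
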